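/- Dissipative preparation of PAC states: let Ψ₀ := Σ_{x ∈ X} a_x |x⟩ with arbitrary complex amplitudes a_x satisfying Σ_x |a_x|² = 1, and let |+̄⟩ := 2^{−N/2}·Σ_{ā ∈ Fin N → Bool} |ā⟩ be the all-|+⟩ ancilla state. Then as t → ∞, the modified evolution converges: E'_t(|Ψ₀⟩⟨Ψ₀| ⊗ |+̄⟩⟨+̄|) → |Φ⟩⟨Φ|, where Φ := Σ_{x ∈ X} a_x |x⟩ ⊗ |C̄(x)⟩ is the pure state recording the evaluation of every clause of the 3-CNF formula in the ancilla register. -/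

import Mathlib

open Matrix Filter
open scoped Kronecker Topology

attribute [local instance] Matrix.normedAddCommGroup Matrix.normedSpace

noncomputable section

/-- The computational basis of `n` qubits, `X = {0,1}ⁿ`. -/
abbrev QubitBasis (n : ℕ) := Fin n → Bool

/-- Evaluation of the 3-literal clause with indices `i₁ i₂ i₃` and bits `b₁ b₂ b₃`:
`C(x) = ¬(x i₁ = b₁ ∧ x i₂ = b₂ ∧ x i₃ = b₃)`. -/
def clauseEval {n : ℕ} (i₁ i₂ i₃ : Fin n) (b₁ b₂ b₃ : Bool) (x : QubitBasis n) : Bool :=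
  ! (decide (x i₁ = b₁) && decide (x i₂ = b₂) && decide (x i₃ = b₃))

/-- The modified Lindblad operator `L'ⱼ = Π⁻ⱼ ⊗ σ⁻ + (I − Π⁻ⱼ) ⊗ σ⁺` on the system and
the `j`-th ancilla: `L'ⱼ((x,ā),(y,b̄)) = 1` iff `x = y`, `ā j = Cⱼ(x)`,
`b̄ j = ¬Cⱼ(x)`, and `ā k = b̄ k` for all `k ≠ j`. -/
def jumpOpN' {n N : ℕ} (C : Fin N → QubitBasis n → Bool) (j : Fin N) :
    Matrix (QubitBasis n × (Fin N → Bool)) (QubitBasis n × (Fin N → Bool)) ℂ :=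
  Matrix.of fun p q =>
    if p.1 = q.1 ∧ p.2 j = C j p.1 ∧ q.2 j = !C j p.1 ∧
        (∀ k, k ≠ j → p.2 k = q.2 k) then 1 else 0

/-- The Lindbladian `ℒ'(ρ) = γ (L ρ L† − (1/2)(L†L ρ + ρ L†L))` as a linear endomorphism
of the matrix space. -/
def lindbladian {d : Type*} [Fintype d] [DecidableEq d] (γ : ℝ) (L : Matrix d d ℂ) :
    Matrix d d ℂ →ₗ[ℂ] Matrix d d ℂ :=
  (γ : ℂ) • ((LinearMap.mulRight ℂ Lᴴ).comp (LinearMap.mulLeft ℂ L)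
    - (1 / 2 : ℂ) • (LinearMap.mulLeft ℂ (Lᴴ * L) + LinearMap.mulRight ℂ (Lᴴ * L)))

/-- The evolution `E'_t = exp(t·ℒ')`. -/
def evol {d : Type*} [Fintype d] [DecidableEq d]
    (L : Matrix d d ℂ →ₗ[ℂ] Matrix d d ℂ) (t : ℝ) :
    Matrix d d ℂ →L[ℂ] Matrix d d ℂ :=
  haveI : IsTopologicalRing (Matrix d d ℂ →L[ℂ] Matrix d d ℂ) :=
    inferInstanceAs (IsTopologicalRing ((d → d → ℂ) →L[ℂ] (d → d → ℂ)))
  NormedSpace.exp ((t : ℂ) • LinearMap.toContinuousLinearMap L)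

/-- Generic uniqueness: a curve solving the linear ODE is given by the exponential. -/
theorem exp_apply_of_hasDerivAt {E : Type*} [NormedAddCommGroup E] [NormedSpace ℂ E]
    [CompleteSpace E] (A : E →L[ℂ] E) (f : ℝ → E)
    (hf : ∀ t, HasDerivAt f (A (f t)) t) (t : ℝ) :
    NormedSpace.exp ((t : ℂ) • A) (f 0) = f t := by
  have hexp : ∀ s : ℝ, HasDerivAt (fun u : ℝ => NormedSpace.exp ((u : ℂ) • A))
      (A * NormedSpace.exp ((s : ℂ) • A)) s := by
    intro s
    have h := hasDerivAt_exp_smul_const' (𝕂 := ℂ) (𝔸 := E →L[ℂ] E) A (s : ℂ)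
    have h2 := HasDerivAt.scomp (𝕜 := ℝ) (𝕜' := ℂ) s h (Complex.ofRealCLM.hasDerivAt (x := s))
    simpa [Function.comp_def] using h2
  have h1 : ∀ s : ℝ, HasDerivAt (fun u : ℝ => NormedSpace.exp ((u : ℂ) • A) (f 0))
      (A (NormedSpace.exp ((s : ℂ) • A) (f 0))) s := by
    intro s
    have h2 : HasDerivAt (fun u : ℝ => ((ContinuousLinearMap.apply ℂ E (f 0)).restrictScalars ℝ)
        (NormedSpace.exp ((u : ℂ) • A))) _ s :=
      (((ContinuousLinearMap.apply ℂ E (f 0)).restrictScalars ℝ).hasFDerivAt).comp_hasDerivAt s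
        (hexp s)
    simpa using h2
  have := ODE_solution_unique_univ (v := fun _ x => A x) (K := ‖A‖₊) (s := fun _ => Set.univ)
    (f := fun u : ℝ => NormedSpace.exp ((u : ℂ) • A) (f 0)) (g := f) (t₀ := 0)
    (fun _ => A.lipschitz.lipschitzOnWith) (fun s => ⟨h1 s, trivial⟩)
    (fun s => ⟨hf s, trivial⟩) (by simp)
  exact congrFun this t

theorem evol_apply_of_hasDerivAt {d : Type*} [Fintype d] [DecidableEq d]
    (L : Matrix d d ℂ →ₗ[ℂ] Matrix d d ℂ) (f : ℝ → Matrix d d ℂ)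
    (hf : ∀ t, HasDerivAt f (L (f t)) t) (t : ℝ) :
    evol L t (f 0) = f t := by
  have : CompleteSpace (Matrix d d ℂ) := inferInstanceAs (CompleteSpace (d → d → ℂ))
  exact exp_apply_of_hasDerivAt (LinearMap.toContinuousLinearMap L) f hf t

/-- flip of ancilla `j` -/
def flipAnc {n N : ℕ} (j : Fin N) (p : QubitBasis n × (Fin N → Bool)) :
    QubitBasis n × (Fin N → Bool) := (p.1, Function.update p.2 j (!p.2 j))

/-- ancilla `j` is in the correct state -/
def good {n N : ℕ} (C : Fin N → QubitBasis n → Bool) (p : QubitBasis n × (Fin N → Bool))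
    (j : Fin N) : Bool := p.2 j == C j p.1

theorem flipAnc_flipAnc {n N : ℕ} (j : Fin N) (p : QubitBasis n × (Fin N → Bool)) :
    flipAnc j (flipAnc j p) = p := by
  simp [flipAnc]

theorem good_flip_same {n N : ℕ} (C : Fin N → QubitBasis n → Bool) (j : Fin N)
    (p : QubitBasis n × (Fin N → Bool)) : good C (flipAnc j p) j = ! good C p j := by
  simp only [good, flipAnc, Function.update_self]
  cases p.2 j <;> cases C j p.1 <;> rfl

theorem good_flip_ne {n N : ℕ} (C : Fin N → QubitBasis n → Bool) {j k : Fin N} (h : k ≠ j)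
    (p : QubitBasis n × (Fin N → Bool)) : good C (flipAnc j p) k = good C p k := by
  simp [good, flipAnc, h]

theorem jump_apply {n N : ℕ} (C : Fin N → QubitBasis n → Bool) (j : Fin N)
    (p q : QubitBasis n × (Fin N → Bool)) :
    jumpOpN' C j p q = if q = flipAnc j p then (if good C p j then 1 else 0) else 0 := by
  rw [← ite_and]
  simp only [jumpOpN', Matrix.of_apply]
  congr 1
  rw [eq_iff_iff]
  obtain ⟨x, u⟩ := p
  obtain ⟨y, w⟩ := q
  simp only [flipAnc, good, Prod.mk.injEq, beq_iff_eq]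
  constructor
  · rintro ⟨rfl, h1, h2, h3⟩
    refine ⟨⟨rfl, ?_⟩, h1⟩
    funext k
    by_cases hk : k = j
    · subst hk; simp [h1, h2]
    · simp [hk, h3 k hk]
  · rintro ⟨⟨rfl, rfl⟩, h⟩
    refine ⟨rfl, h, by simp [h], fun k hk => by simp [hk]⟩

theorem jump_apply' {n N : ℕ} (C : Fin N → QubitBasis n → Bool) (j : Fin N)
    (p q : QubitBasis n × (Fin N → Bool)) :
    jumpOpN' C j p q = if p = flipAnc j q then (if good C q j then 0 else 1) else 0 := by
  rw [jump_apply]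
  by_cases h : p = flipAnc j q
  · subst h
    simp [flipAnc_flipAnc, good_flip_same]
    cases good C q j <;> simp
  · have : q ≠ flipAnc j p := by
      rintro rfl
      exact h (flipAnc_flipAnc j p).symm
    simp [h, this]

theorem jump_mul {n N : ℕ} (C : Fin N → QubitBasis n → Bool) (j : Fin N)
    (M : Matrix (QubitBasis n × (Fin N → Bool)) (QubitBasis n × (Fin N → Bool)) ℂ)
    (p q : QubitBasis n × (Fin N → Bool)) :
    (jumpOpN' C j * M) p q = if good C p j then M (flipAnc j p) q else 0 := by
  simp [Matrix.mul_apply, jump_apply]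

theorem mul_jumpH {n N : ℕ} (C : Fin N → QubitBasis n → Bool) (j : Fin N)
    (M : Matrix (QubitBasis n × (Fin N → Bool)) (QubitBasis n × (Fin N → Bool)) ℂ)
    (p q : QubitBasis n × (Fin N → Bool)) :
    (M * (jumpOpN' C j)ᴴ) p q = if good C q j then M p (flipAnc j q) else 0 := by
  simp only [Matrix.mul_apply, Matrix.conjTranspose_apply, jump_apply]
  cases good C q j <;> simp [apply_ite]

theorem jumpH_jump {n N : ℕ} (C : Fin N → QubitBasis n → Bool) (j : Fin N) :
    (jumpOpN' C j)ᴴ * jumpOpN' C j = Matrix.diagonal fun p => if good C p j then (0:ℂ) else 1 := by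
  ext p q
  have : ((jumpOpN' C j)ᴴ * jumpOpN' C j) p q
      = if good C p j then 0 else jumpOpN' C j (flipAnc j p) q := by
    simp only [Matrix.mul_apply, Matrix.conjTranspose_apply]
    simp only [jump_apply' C j _ p]
    cases good C p j <;> simp [apply_ite]
  rw [this, jump_apply, flipAnc_flipAnc, good_flip_same, Matrix.diagonal_apply]
  by_cases h : p = q
  · subst h; cases good C p j <;> simp
  · simp [h, Ne.symm h]

theorem lindblad_apply {n N : ℕ} (C : Fin N → QubitBasis n → Bool) (j : Fin N) (γ : ℝ)
    (M : Matrix (QubitBasis n × (Fin N → Bool)) (QubitBasis n × (Fin N → Bool)) ℂ)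
    (p q : QubitBasis n × (Fin N → Bool)) :
    lindbladian γ (jumpOpN' C j) M p q =
      γ * ((if good C q j then if good C p j then M (flipAnc j p) (flipAnc j q) else 0 else 0)
        - 1 / 2 * ((if good C p j then 0 else 1) * M p q
          + M p q * (if good C q j then 0 else 1))) := by
  simp only [lindbladian, jumpH_jump, LinearMap.smul_apply, LinearMap.sub_apply,
    LinearMap.add_apply, LinearMap.comp_apply, LinearMap.mulLeft_apply, LinearMap.mulRight_apply,
    Matrix.smul_apply, Matrix.sub_apply, Matrix.add_apply, smul_eq_mul, mul_jumpH, jump_mul,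
    Matrix.diagonal_mul, Matrix.mul_diagonal]

/-- single-ancilla solution -/
def damp (γ : ℝ) (g h : Bool) (t : ℝ) : ℝ :=
  if g then (if h then 1 - Real.exp (-γ * t) / 2 else Real.exp (-(γ / 2) * t) / 2)
  else (if h then Real.exp (-(γ / 2) * t) / 2 else Real.exp (-γ * t) / 2)

/-- its time derivative -/
def damp' (γ : ℝ) (g h : Bool) (t : ℝ) : ℝ :=
  γ * ((if h then if g then damp γ (!g) (!h) t else 0 else 0)
        - 1 / 2 * ((if g then 0 else 1) * damp γ g h t
          + damp γ g h t * (if h then 0 else 1)))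

theorem damp_deriv (γ : ℝ) (g h : Bool) (t : ℝ) :
    HasDerivAt (damp γ g h) (damp' γ g h t) t := by
  have e : ∀ c : ℝ, HasDerivAt (fun t : ℝ => Real.exp (c * t) / 2)
      (Real.exp (c * t) * c / 2) t := by
    intro c
    have := ((hasDerivAt_id t).const_mul c).exp.div_const 2
    simpa using this
  cases g <;> cases h
  · refine HasDerivAt.congr_deriv (e (-γ)) ?_; simp [damp', damp]; ring
  · refine HasDerivAt.congr_deriv (e (-(γ/2))) ?_; simp [damp', damp]; ring
  · refine HasDerivAt.congr_deriv (e (-(γ/2))) ?_; simp [damp', damp]; ring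
  · refine HasDerivAt.congr_deriv ((e (-γ)).const_sub 1) ?_; simp [damp', damp]; ring

theorem damp_tendsto (γ : ℝ) (hγ : 0 < γ) (g h : Bool) :
    Tendsto (damp γ g h) atTop (𝓝 (if g then (if h then 1 else 0) else 0)) := by
  have e : ∀ c : ℝ, 0 < c → Tendsto (fun t : ℝ => Real.exp (-c * t) / 2) atTop (𝓝 0) := by
    intro c hc
    have h1 : Tendsto (fun t : ℝ => -c * t) atTop atBot :=
      tendsto_id.const_mul_atTop_of_neg (by linarith)
    simpa using (Real.tendsto_exp_atBot.comp h1).div_const 2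
  cases g <;> cases h
  · exact e γ hγ
  · exact e (γ/2) (by linarith)
  · exact e (γ/2) (by linarith)
  · have h1 := (e γ hγ).const_sub 1
    rw [sub_zero] at h1
    exact h1

/-- explicit solution -/
def sol {n N : ℕ} (C : Fin N → QubitBasis n → Bool) (γ : ℝ) (a : QubitBasis n → ℂ) (t : ℝ) :
    Matrix (QubitBasis n × (Fin N → Bool)) (QubitBasis n × (Fin N → Bool)) ℂ :=
  Matrix.of fun p q => a p.1 * star (a q.1) *
    ((∏ j, damp γ (good C p j) (good C q j) t : ℝ) : ℂ)

theorem sol_deriv {n N : ℕ} (C : Fin N → QubitBasis n → Bool) (γ : ℝ) (a : QubitBasis n → ℂ)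
    (t : ℝ) : HasDerivAt (sol C γ a)
      ((∑ j, lindbladian γ (jumpOpN' C j)) (sol C γ a t)) t := by
  refine hasDerivAt_pi.2 fun p => hasDerivAt_pi.2 fun q => ?_
  have h := ((HasDerivAt.fun_finsetProd (u := Finset.univ)
    (fun j _ => damp_deriv γ (good C p j) (good C q j) t)).ofReal_comp).const_mul
      (a p.1 * star (a q.1))
  refine h.congr_deriv ?_
  rw [LinearMap.sum_apply, Matrix.sum_apply]
  push_cast
  rw [Finset.mul_sum]
  refine Finset.sum_congr rfl fun j _ => ?_
  rw [lindblad_apply]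
  have hs : ∀ p q, sol C γ a t p q = a p.1 * star (a q.1) *
      ((∏ k ∈ Finset.univ.erase j, (damp γ (good C p k) (good C q k) t : ℂ)) *
        (damp γ (good C p j) (good C q j) t : ℂ)) := by
    intro p q
    rw [Finset.prod_erase_mul _ _ (Finset.mem_univ j)]
    simp [sol]
  have hf : sol C γ a t (flipAnc j p) (flipAnc j q) = a p.1 * star (a q.1) *
      ((∏ k ∈ Finset.univ.erase j, (damp γ (good C p k) (good C q k) t : ℂ)) *
        (damp γ (!good C p j) (!good C q j) t : ℂ)) := by
    rw [hs, good_flip_same, good_flip_same]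
    congr 2
    refine Finset.prod_congr rfl fun k hk => ?_
    rw [good_flip_ne C (Finset.ne_of_mem_erase hk), good_flip_ne C (Finset.ne_of_mem_erase hk)]
  rw [hf, hs]
  simp only [damp', smul_eq_mul]
  cases good C p j <;> cases good C q j <;> simp <;> ring

/-- dissipative preparation of PAC states: for any normalized
amplitudes `a`, `E'_t(|Ψ₀⟩⟨Ψ₀| ⊗ |+̄⟩⟨+̄|) → |Φ⟩⟨Φ|` as `t → ∞`, where
`Φ = Σ_x a_x |x⟩ ⊗ |C̄(x)⟩` records the evaluation of every clause. -/
theorem pac_state_preparation {n N : ℕ} (hn : 1 ≤ n) (hN : 1 ≤ N)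
    (i₁ i₂ i₃ : Fin N → Fin n)
    (h₁₂ : ∀ j, i₁ j ≠ i₂ j) (h₁₃ : ∀ j, i₁ j ≠ i₃ j) (h₂₃ : ∀ j, i₂ j ≠ i₃ j)
    (b₁ b₂ b₃ : Fin N → Bool) (γ : ℝ) (hγ : 0 < γ)
    (C : Fin N → QubitBasis n → Bool)
    (hC : ∀ j, C j = clauseEval (i₁ j) (i₂ j) (i₃ j) (b₁ j) (b₂ j) (b₃ j))
    (a : QubitBasis n → ℂ) (ha : ∑ x : QubitBasis n, Complex.normSq (a x) = 1)
    (plus : (Fin N → Bool) → ℂ)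
    (hplus : plus = fun _ => ((Real.sqrt (2 ^ N) : ℝ) : ℂ)⁻¹)
    (Φ : QubitBasis n × (Fin N → Bool) → ℂ)
    (hΦ : Φ = fun p => if p.2 = (fun j => C j p.1) then a p.1 else 0) :
    Tendsto
      (fun t : ℝ => evol (∑ j, lindbladian γ (jumpOpN' C j)) t
        (Matrix.vecMulVec a (star a) ⊗ₖ Matrix.vecMulVec plus (star plus)))
      atTop
      (𝓝 (Matrix.vecMulVec Φ (star Φ))) := by
  have h0 : Matrix.vecMulVec a (star a) ⊗ₖ Matrix.vecMulVec plus (star plus) = sol C γ a 0 := by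
    ext p q
    have hd : ∀ g h, damp γ g h 0 = 1 / 2 := by
      intro g h; cases g <;> cases h <;> norm_num [damp]
    have hsq : ((Real.sqrt (2 ^ N) : ℝ) : ℂ)⁻¹ * ((Real.sqrt (2 ^ N) : ℝ) : ℂ)⁻¹
        = ((1 / 2 : ℝ) ^ N : ℝ) := by
      rw [← mul_inv, ← Complex.ofReal_mul, Real.mul_self_sqrt (by positivity)]
      simp
    have hst : star (((Real.sqrt (2 ^ N) : ℝ) : ℂ)⁻¹) = ((Real.sqrt (2 ^ N) : ℝ) : ℂ)⁻¹ := by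
      simp
    rw [Matrix.kroneckerMap_apply, Matrix.vecMulVec_apply, Matrix.vecMulVec_apply]
    simp only [sol, Matrix.of_apply, hd, Finset.prod_const, Finset.card_univ, Fintype.card_fin,
      hplus, Pi.star_apply, hst, hsq]
  have hev : ∀ t, evol (∑ j, lindbladian γ (jumpOpN' C j)) t
      (Matrix.vecMulVec a (star a) ⊗ₖ Matrix.vecMulVec plus (star plus)) = sol C γ a t := by
    intro t
    rw [h0]
    exact evol_apply_of_hasDerivAt _ _ (sol_deriv C γ a) t
  simp only [hev]
  refine tendsto_pi_nhds.2 fun p => tendsto_pi_nhds.2 fun q => ?_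
  have h := ((Complex.continuous_ofReal.tendsto _).comp (tendsto_finsetProd Finset.univ
    (fun j _ => damp_tendsto γ hγ (good C p j) (good C q j)))).const_mul (a p.1 * star (a q.1))
  refine Tendsto.congr (fun t => rfl) (h.trans (le_of_eq (congrArg 𝓝 (Eq.symm ?_))))
  have hp : ∀ p : QubitBasis n × (Fin N → Bool),
      Φ p = if ∀ j, good C p j = true then a p.1 else 0 := by
    intro p
    rw [hΦ]
    simp [good, funext_iff]
  rw [Matrix.vecMulVec_apply, Pi.star_apply, hp, hp]
  by_cases h1 : ∀ j, good C p j = true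
  · by_cases h2 : ∀ j, good C q j = true
    · simp [h1, h2]
    · rw [if_neg h2]
      push Not at h2
      obtain ⟨j, hj⟩ := h2
      rw [Finset.prod_eq_zero (Finset.mem_univ j) (by simp [hj])]
      simp
  · rw [if_neg h1]
    push Not at h1
    obtain ⟨j, hj⟩ := h1
    rw [Finset.prod_eq_zero (Finset.mem_univ j) (by simp [hj])]
    simp
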